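/- arXiv:2111.11663 — 2 statements merged into one kernel-verified Lean document; each statement's English description precedes it below -/
import Mathlib

section
/- There exist constants λ, μ ∈ ℂ such that for every t ∈ ℂ ∖ ({0} ∪ {±q^k : k ∈ ℤ}): u_C(t) = λ g(t) h^α(t) u_A(t) + μ g(t) u_B(t) and v_C(t) = λ g(t) h^α(t) v_A(t) + μ g(t) v_B(t). That is, the solution at infinity S_C equals a constant multiple of g·h^α·S_A plus a constant multiple of g·S_B (the connection formula S_C(t) = g(t) h^α(t) S_A(t) + g(t) S_B(t) after absorbing constants into the power series). -/
/-- The function `g(z) = ∏_{j=0}^∞ (1 - q^{2j+2} z²)(1 - q^{2j} z^{-2})`. -/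
noncomputable def gFun (q : ℝ) (z : ℂ) : ℂ :=
  ∏' j : ℕ, ((1 - (q : ℂ) ^ (2 * j + 2) * z ^ 2) * (1 - (q : ℂ) ^ (2 * j) * (z ^ 2)⁻¹))

/-- The function `h^α(z) = Σ_{k=-∞}^∞ 2 z q^{k(1+α)} / (z² - q^{2k})`. -/
noncomputable def hAlpha (q α : ℝ) (z : ℂ) : ℂ :=
  ∑' k : ℤ, 2 * z * ((q ^ ((k : ℝ) * (1 + α)) : ℝ) : ℂ) / (z ^ 2 - (q : ℂ) ^ (2 * k))

section Aux
open Complex Metric Set Filter Topology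

noncomputable def Jc (f : ℂ → ℂ) (n : ℤ) (r : ℝ) : ℂ :=
  ∫ θ in (0:ℝ)..2 * Real.pi, (circleMap 0 r θ) ^ (-n) * f (circleMap 0 r θ)

lemma Jc_eq (f : ℂ → ℂ) (n : ℤ) (r : ℝ) (hr : 0 < r) :
    (∮ z in C(0, r), (z - 0)⁻¹ • (z ^ (-n) * f z)) = I * Jc f n r := by
  rw [circleIntegral, Jc, ← intervalIntegral.integral_const_mul]
  congr 1
  ext θ
  have : circleMap 0 r θ ≠ 0 := circleMap_ne_center hr.ne'
  simp only [deriv_circleMap, smul_eq_mul, sub_zero]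
  field_simp

lemma Jc_indep (f : ℂ → ℂ) (n : ℤ) (ρ r R : ℝ) (hρ : 0 < ρ) (h1 : ρ < r) (h2 : r ≤ R)
    (h3 : R < ρ⁻¹) (hf : ∀ z : ℂ, ρ < ‖z‖ → ‖z‖ < ρ⁻¹ → DifferentiableAt ℂ f z) :
    Jc f n R = Jc f n r := by
  have hr : 0 < r := hρ.trans h1
  have hd : ∀ z : ℂ, r ≤ ‖z‖ → ‖z‖ ≤ R → DifferentiableAt ℂ (fun z => z ^ (-n) * f z) z := by
    intro z hz1 hz2
    have hz : z ≠ 0 := by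
      rw [← norm_pos_iff]; linarith
    exact (differentiableAt_zpow.2 (Or.inl hz)).mul (hf z (by linarith) (by linarith))
  have := circleIntegral_sub_center_inv_smul_eq_of_differentiable_on_annulus_off_countable
    (c := 0) hr h2 (f := fun z => z ^ (-n) * f z) (s := ∅) countable_empty
    (by
      intro z hz
      simp only [Set.mem_sdiff, mem_closedBall, dist_zero_right, mem_ball, not_lt] at hz
      exact (hd z hz.2 hz.1).continuousAt.continuousWithinAt)
    (by
      intro z hz
      simp only [Set.mem_sdiff, mem_closedBall, dist_zero_right, mem_ball, not_le] at hz
      exact hd z hz.1.2.le hz.1.1.le)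
  rw [Jc_eq f n R (by linarith), Jc_eq f n r hr] at this
  exact mul_left_cancel₀ I_ne_zero this

lemma Jc_zero (f : ℂ → ℂ) (r : ℝ) (hr : 0 < r) (hc : ∀ z : ℂ, ‖z‖ = r → ContinuousAt f z)
    (h0 : ∀ n, Jc f n r = 0) (z : ℂ) (hz : ‖z‖ = r) : f z = 0 := by
  have : Fact (0 < 2 * Real.pi) := ⟨by positivity⟩
  have hnorm : ∀ x : AddCircle (2 * Real.pi), ‖((r : ℂ) * (AddCircle.toCircle x : ℂ))‖ = r := by
    intro x; rw [norm_mul, Circle.norm_coe]; simp [abs_of_pos hr]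
  have hcont : Continuous (fun x : AddCircle (2 * Real.pi) => f (r * (AddCircle.toCircle x : ℂ))) := by
    rw [continuous_iff_continuousAt]
    intro x
    refine ContinuousAt.comp (g := f) (f := fun x : AddCircle (2 * Real.pi) =>
      (r : ℂ) * (AddCircle.toCircle x : ℂ)) (hc _ (hnorm x)) ?_
    have := (AddCircle.continuous_toCircle (T := 2 * Real.pi))
    fun_prop
  let F : C(AddCircle (2 * Real.pi), ℂ) := ⟨_, hcont⟩
  have hmap : ∀ θ : ℝ, (r : ℂ) * (AddCircle.toCircle (θ : AddCircle (2 * Real.pi)) : ℂ) = circleMap 0 r θ := by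
    intro θ
    rw [AddCircle.toCircle_apply_mk, Circle.coe_exp, circleMap]
    have : (2 * Real.pi / (2 * Real.pi) * θ) = θ := by field_simp
    rw [this]; simp
  have hF : ∀ n, fourierCoeff F n = 0 := by
    intro n
    rw [fourierCoeff_eq_intervalIntegral _ _ 0]
    have hh : ∀ θ : ℝ, fourier (-n) (θ : AddCircle (2 * Real.pi)) • F θ =
        (r : ℂ) ^ n * ((circleMap 0 r θ) ^ (-n) * f (circleMap 0 r θ)) := by
      intro θ
      have h1 : F θ = f (circleMap 0 r θ) := by
        show f _ = _
        rw [hmap]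
      rw [h1, fourier_apply, AddCircle.toCircle_zsmul, ← hmap θ, mul_zpow, smul_eq_mul]
      have : (r : ℂ) ≠ 0 := by exact_mod_cast hr.ne'
      simp only [Circle.coe_zpow]
      rw [zpow_neg (r : ℂ)]
      field_simp
    simp_rw [hh]
    rw [intervalIntegral.integral_const_mul]
    have := h0 n
    rw [Jc] at this
    rw [zero_add, this]; simp
  have hs : Summable (fourierCoeff F) := by
    have : fourierCoeff F = 0 := funext hF
    rw [this]; exact summable_zero
  have h := hasSum_fourier_series_of_summable hs
  simp only [hF, zero_smul] at h
  have hF0 : F = 0 := h.unique hasSum_zero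
  have : F (z.arg : ℝ) = f z := by
    show f _ = _
    rw [hmap, circleMap, zero_add, ← hz, norm_mul_exp_arg_mul_I]
  rw [← this, hF0]; rfl

lemma Jc_shift (f : ℂ → ℂ) (n : ℤ) (q r : ℝ) (κ : ℂ) (hq : 0 < q) (hr : 0 < r)
    (hf : ∀ z : ℂ, ‖z‖ = r → f (q * z) = κ * (z ^ 2)⁻¹ * f z) :
    Jc f n (q * r) = (q : ℂ) ^ (-n) * κ * Jc f (n + 2) r := by
  rw [Jc, Jc, ← intervalIntegral.integral_const_mul]
  congr 1
  ext θ
  have h1 : circleMap 0 (q * r) θ = q * circleMap 0 r θ := by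
    simp [circleMap]; ring
  have hz : circleMap 0 r θ ≠ 0 := circleMap_ne_center hr.ne'
  rw [h1, hf _ (by simp [abs_of_pos hr]), mul_zpow, neg_add, zpow_add₀ hz]
  have : circleMap 0 r θ ^ (-2 : ℤ) = (circleMap 0 r θ ^ 2)⁻¹ := by
    rw [zpow_neg]; rfl
  rw [this]; ring

lemma Jc_odd (f : ℂ → ℂ) (n : ℤ) (r : ℝ) (hn : Odd n)
    (hf : ∀ z : ℂ, ‖z‖ = r → f (-z) = f z) (hr : 0 < r) : Jc f n r = 0 := by
  set φ : ℝ → ℂ := fun θ => (circleMap 0 r θ) ^ (-n) * f (circleMap 0 r θ) with hφ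
  have hper : Function.Periodic φ (2 * Real.pi) := by
    intro θ
    simp only [hφ, periodic_circleMap 0 r θ]
  have hanti : ∀ θ, φ (θ + Real.pi) = - φ θ := by
    intro θ
    have h1 : circleMap 0 r (θ + Real.pi) = - circleMap 0 r θ := by
      simp [circleMap, add_mul, exp_add]
    simp only [hφ]
    rw [h1, hf _ (by simp [abs_of_pos hr]), hn.neg.neg_zpow]; ring
  have h1 := hper.intervalIntegral_add_eq Real.pi 0
  have h2 : (∫ θ in (0:ℝ)..2 * Real.pi, φ (θ + Real.pi)) = ∫ θ in (0 + Real.pi)..(2*Real.pi + Real.pi), φ θ :=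
    intervalIntegral.integral_comp_add_right φ Real.pi
  simp_rw [hanti] at h2
  rw [intervalIntegral.integral_neg] at h2
  rw [zero_add] at h2 h1
  rw [add_comm, h2.symm.trans rfl] at h1
  have h3 : Jc f n r = ∫ θ in (0:ℝ)..2 * Real.pi, φ θ := rfl
  rw [h3]
  exact self_eq_neg.1 h1.symm

/-- The space of functions considered. -/
structure Sp (q ρ : ℝ) (κ : ℂ) (f : ℂ → ℂ) : Prop where
  diff : ∀ z : ℂ, ρ < ‖z‖ → ‖z‖ < ρ⁻¹ → DifferentiableAt ℂ f z
  even : ∀ z : ℂ, ρ < ‖z‖ → ‖z‖ < ρ⁻¹ → f (-z) = f z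
  feq : ∀ z : ℂ, ‖z‖ = (√q)⁻¹ → f (q * z) = κ * (z ^ 2)⁻¹ * f z

lemma Sp.zero {q ρ : ℝ} {κ : ℂ} {f : ℂ → ℂ} (hq : 0 < q) (hq1 : q < 1) (hρ : 0 < ρ)
    (hρq : ρ < √q) (hκ : κ ≠ 0) (hf : Sp q ρ κ f) (h0 : Jc f 0 1 = 0) (z : ℂ)
    (h1 : ρ < ‖z‖) (h2 : ‖z‖ < ρ⁻¹) : f z = 0 := by
  have hs : 0 < √q := Real.sqrt_pos.2 hq
  have hs1 : √q < 1 := by rw [Real.sqrt_lt' one_pos]; simpa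
  have hsi : 1 < (√q)⁻¹ := (one_lt_inv₀ hs).2 hs1
  have hsr : (√q)⁻¹ < ρ⁻¹ := (inv_lt_inv₀ hs hρ).2 hρq
  have hqs : q * (√q)⁻¹ = √q := by
    rw [← div_eq_mul_inv, Real.div_sqrt]
  have hind : ∀ n r, ρ < r → r < ρ⁻¹ → Jc f n r = Jc f n 1 := by
    intro n r h1 h2
    rcases le_total r 1 with h | h
    · exact (Jc_indep f n ρ r 1 hρ h1 h (by linarith) hf.diff).symm
    · exact (Jc_indep f n ρ 1 r hρ (by linarith) h h2 hf.diff)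
  have hrec : ∀ n, Jc f n 1 = (q : ℂ) ^ (-n) * κ * Jc f (n + 2) 1 := by
    intro n
    have := Jc_shift f n q (√q)⁻¹ κ hq (by positivity) hf.feq
    rw [hqs, hind _ _ hρq (by linarith), hind _ _ (by linarith) hsr] at this
    exact this
  have hqc : (q : ℂ) ≠ 0 := by exact_mod_cast hq.ne'
  have heven : ∀ m : ℤ, Jc f (2 * m) 1 = 0 := by
    intro m
    induction m using Int.induction_on with
    | zero => simpa using h0
    | succ i ih =>
      have := hrec (2 * i)
      rw [ih] at this
      have h3 : (q : ℂ) ^ (-(2 * (i : ℤ))) * κ ≠ 0 := mul_ne_zero (zpow_ne_zero _ hqc) hκ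
      have := (mul_eq_zero.1 this.symm).resolve_left h3
      rw [← this]; congr 1
    | pred i ih =>
      rw [hrec]
      have : 2 * (-(i : ℤ) - 1) + 2 = 2 * (-(i : ℤ)) := by ring
      rw [this, ih, mul_zero]
  have hall : ∀ n, Jc f n 1 = 0 := by
    intro n
    rcases Int.even_or_odd' n with ⟨k, hk | hk⟩
    · rw [hk, heven]
    · exact Jc_odd f n 1 ⟨k, hk⟩ (fun z hz => hf.even z (by rw [hz]; linarith) (by rw [hz]; linarith)) one_pos
  refine Jc_zero f ‖z‖ (by linarith) (fun w hw => (hf.diff w (by rwa [hw]) (by rwa [hw])).continuousAt)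
    (fun n => by rw [hind n _ h1 h2, hall]) z rfl

lemma Sp.dep {q ρ : ℝ} {κ : ℂ} {f g : ℂ → ℂ} (hq : 0 < q) (hq1 : q < 1) (hρ : 0 < ρ)
    (hρq : ρ < √q) (hκ : κ ≠ 0) (hf : Sp q ρ κ f) (hg : Sp q ρ κ g)
    (x : ℂ) (hx : ‖x‖ = 1) (hgx : g x ≠ 0) :
    ∃ l : ℂ, ∀ z : ℂ, ρ < ‖z‖ → ‖z‖ < ρ⁻¹ → f z = l * g z := by
  have hs : 0 < √q := Real.sqrt_pos.2 hq
  have hs1 : √q < 1 := by rw [Real.sqrt_lt' one_pos]; simpa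
  have hρ1 : ρ < 1 := by linarith
  have hρi : 1 < ρ⁻¹ := (one_lt_inv₀ hρ).2 hρ1
  have hg0 : Jc g 0 1 ≠ 0 := fun h =>
    hgx (hg.zero hq hq1 hρ hρq hκ h x (by rw [hx]; linarith) (by rw [hx]; linarith))
  refine ⟨Jc f 0 1 / Jc g 0 1, fun z h1 h2 => ?_⟩
  have hcirc : ∀ F, Sp q ρ κ F → IntervalIntegrable (fun θ => F (circleMap 0 1 θ)) MeasureTheory.volume 0 (2*Real.pi) := by
    intro F hF
    apply Continuous.intervalIntegrable
    rw [continuous_iff_continuousAt]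
    intro θ
    apply ContinuousAt.comp (g := F) (hF.diff _ (by simpa) (by simpa)).continuousAt
    exact (continuous_circleMap 0 1).continuousAt
  have hS : Sp q ρ κ (fun z => f z - Jc f 0 1 / Jc g 0 1 * g z) := by
    refine ⟨fun z h1 h2 => (hf.diff z h1 h2).sub ((hg.diff z h1 h2).const_mul _), fun z h1 h2 => ?_, fun z h => ?_⟩
    · simp only [hf.even z h1 h2, hg.even z h1 h2]
    · simp only [hf.feq z h, hg.feq z h]; ring
  have := hS.zero hq hq1 hρ hρq hκ (by
    have e1 : ∀ F, Jc F 0 1 = ∫ θ in (0:ℝ)..2 * Real.pi, F (circleMap 0 1 θ) := by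
      intro F; simp [Jc]
    rw [e1, intervalIntegral.integral_sub (hcirc f hf) ((hcirc g hg).const_mul _),
      intervalIntegral.integral_const_mul, ← e1, ← e1]
    field_simp; simp) z h1 h2
  exact sub_eq_zero.1 this

/-- Auxiliary product. -/
noncomputable def Pq (q : ℝ) (w : ℂ) : ℂ := ∏' j : ℕ, (1 + -((q : ℂ) ^ (2 * j + 2) * w))

lemma Pq_summable {q : ℝ} (hq : 0 < q) (hq1 : q < 1) (m : ℕ) (w : ℂ) :
    Summable (fun j : ℕ => ‖-((q : ℂ) ^ (2 * j + m) * w)‖) := by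
  have : (fun j : ℕ => ‖-((q : ℂ) ^ (2 * j + m) * w)‖) = fun j => (q ^ 2) ^ j * (q ^ m * ‖w‖) := by
    ext j
    rw [norm_neg, norm_mul, norm_pow, norm_real, Real.norm_of_nonneg hq.le, pow_add, pow_mul]; ring
  rw [this]
  exact (summable_geometric_of_lt_one (by positivity) (by nlinarith)).mul_right _

lemma Pq_mult {q : ℝ} (hq : 0 < q) (hq1 : q < 1) (m : ℕ) (w : ℂ) :
    Multipliable (fun j : ℕ => 1 + -((q : ℂ) ^ (2 * j + m) * w)) :=
  multipliable_one_add_of_summable (Pq_summable hq hq1 m w)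

lemma Pq_diff {q : ℝ} (hq : 0 < q) (hq1 : q < 1) : Differentiable ℂ (Pq q) := by
  intro w
  have hu := Pq_summable hq hq1 2 ((‖w‖ + 1 : ℝ) : ℂ)
  have h := Summable.hasProdLocallyUniformlyOn_nat_one_add (K := ball (0:ℂ) (‖w‖ + 1))
    (f := fun j w => -((q : ℂ) ^ (2 * j + 2) * w)) isOpen_ball hu
    (Eventually.of_forall fun j z hz => by
      rw [mem_ball, dist_zero_right] at hz
      simp only [norm_neg, norm_mul, norm_real]
      gcongr
      exact hz.le.trans (le_abs_self _))
    (fun j => by fun_prop)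
  have hd := h.differentiableOn (Eventually.of_forall fun s => by
      apply DifferentiableOn.fun_finsetProd
      intro i _
      fun_prop) isOpen_ball
  exact hd.differentiableAt (isOpen_ball.mem_nhds (by simp))

lemma Pq_ne {q : ℝ} (hq : 0 < q) (hq1 : q < 1) (w : ℂ)
    (h : ∀ j : ℕ, 1 + -((q : ℂ) ^ (2 * j + 2) * w) ≠ 0) : Pq q w ≠ 0 :=
  tprod_one_add_ne_zero_of_summable h (Pq_summable hq hq1 2 w)

lemma Pq_one {q : ℝ} (hq : 0 < q) (hq1 : q < 1) : Pq q 1 ≠ 0 := by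
  apply Pq_ne hq hq1
  intro j h
  have h2 : q ^ (2 * j + 2) < 1 := pow_lt_one₀ hq.le hq1 (by omega)
  have : (1:ℝ) + -(q ^ (2 * j + 2) * 1) = 0 := by exact_mod_cast h
  linarith

lemma Pq_neg_one {q : ℝ} (hq : 0 < q) (hq1 : q < 1) : Pq q (-1) ≠ 0 := by
  apply Pq_ne hq hq1
  intro j h
  have h2 : 0 < q ^ (2 * j + 2) := by positivity
  have : (1:ℝ) + -(q ^ (2 * j + 2) * (-1)) = 0 := by exact_mod_cast h
  linarith

lemma Pq_split {q : ℝ} (hq : 0 < q) (hq1 : q < 1) (w : ℂ) :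
    ∏' j : ℕ, (1 + -((q : ℂ) ^ (2 * j) * w)) = (1 - w) * Pq q w := by
  rw [tprod_eq_zero_mul' (by
    have := Pq_mult hq hq1 2 w
    simpa only [mul_add, mul_one] using this)]
  simp [Pq, mul_add, sub_eq_add_neg]

lemma Pq_feq {q : ℝ} (hq : 0 < q) (hq1 : q < 1) (w : ℂ) :
    Pq q w = (1 - (q:ℂ) ^ 2 * w) * Pq q ((q:ℂ) ^ 2 * w) := by
  rw [← Pq_split hq hq1, Pq]
  congr 1; ext j; ring

lemma g_eq {q : ℝ} (hq : 0 < q) (hq1 : q < 1) (z : ℂ) :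
    gFun q z = Pq q (z ^ 2) * ((1 - (z ^ 2)⁻¹) * Pq q ((z ^ 2)⁻¹)) := by
  rw [← Pq_split hq hq1, Pq, gFun, ← Multipliable.tprod_mul (Pq_mult hq hq1 2 _)
    (by simpa using Pq_mult hq hq1 0 (z ^ 2)⁻¹)]
  simp only [sub_eq_add_neg]

lemma g_feq {q : ℝ} (hq : 0 < q) (hq1 : q < 1) (z : ℂ) (hz : z ≠ 0) :
    gFun q (q * z) = (-1 / ((q:ℂ) ^ 2 * z ^ 2)) * gFun q z := by
  have hqc : (q : ℂ) ≠ 0 := by exact_mod_cast hq.ne'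
  rw [g_eq hq hq1, g_eq hq hq1, mul_pow, Pq_feq hq hq1 (z ^ 2), Pq_feq hq hq1 (((q:ℂ) ^ 2 * z ^ 2)⁻¹)]
  have : (q:ℂ) ^ 2 * ((q:ℂ) ^ 2 * z ^ 2)⁻¹ = (z ^ 2)⁻¹ := by field_simp
  rw [this]
  field_simp
  ring

lemma g_neg (q : ℝ) (z : ℂ) : gFun q (-z) = gFun q z := by simp [gFun]

lemma h_neg (q α : ℝ) (z : ℂ) : hAlpha q α (-z) = -hAlpha q α z := by
  rw [hAlpha, hAlpha, ← tsum_neg]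
  congr 1; ext k; rw [neg_sq]; ring

lemma h_feq {q : ℝ} (α : ℝ) (hq : 0 < q) (z : ℂ) :
    hAlpha q α (q * z) = ((q ^ α : ℝ) : ℂ) * hAlpha q α z := by
  have hqc : (q : ℂ) ≠ 0 := by exact_mod_cast hq.ne'
  rw [hAlpha, hAlpha, ← tsum_mul_left, ← (Equiv.addRight (1:ℤ)).tsum_eq]
  congr 1; ext k
  have h1 : q ^ (((k + 1 : ℤ) : ℝ) * (1 + α)) = q ^ ((k:ℝ) * (1 + α)) * q * q ^ α := by
    rw [mul_assoc]
    nth_rw 3 [← Real.rpow_one q]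
    rw [← Real.rpow_add hq, ← Real.rpow_add hq]; congr 1; push_cast; ring
  have h2 : ((q:ℂ) * z) ^ 2 - (q:ℂ) ^ (2 * (k + 1)) = q ^ 2 * (z ^ 2 - (q:ℂ) ^ (2 * k)) := by
    rw [mul_add, zpow_add₀ hqc]
    have : (q:ℂ) ^ (2 * 1 : ℤ) = q ^ 2 := by rw [mul_one]; rfl
    rw [this]; ring
  simp only [Equiv.coe_addRight]
  rw [h1, h2]
  push_cast
  rw [← div_div]
  have : 2 * (q * z) * (((q ^ ((k:ℝ) * (1 + α)) : ℝ) : ℂ) * q * ((q ^ α : ℝ) : ℂ)) / (q:ℂ) ^ 2 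
    = ((q ^ α : ℝ) : ℂ) * (2 * z * ((q ^ ((k:ℝ) * (1 + α)) : ℝ) : ℂ)) := by
    field_simp
  rw [this, mul_div_assoc]

/-- Terms of `h`. -/
noncomputable def hT (q α : ℝ) (k : ℤ) (z : ℂ) : ℂ :=
  2 * z * ((q ^ ((k : ℝ) * (1 + α)) : ℝ) : ℂ) / (z ^ 2 - (q : ℂ) ^ (2 * k))

/-- Majorant. -/
noncomputable def hU (q α ρ : ℝ) (k : ℤ) : ℝ :=
  2 * ρ⁻¹ * (ρ ^ 2 - q ^ 2)⁻¹ * q ^ ((k:ℝ) * (1 + α)) * (if 0 ≤ k then 1 else q ^ (-2 * (k:ℝ)))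

lemma hU_summable {q α ρ : ℝ} (hq : 0 < q) (hq1 : q < 1) (hα1 : -1 < α) (hα2 : α < 1) :
    Summable (hU q α ρ) := by
  apply Summable.of_nat_of_neg
  · have : (fun n : ℕ => hU q α ρ n) = fun n : ℕ => 2 * ρ⁻¹ * (ρ ^ 2 - q ^ 2)⁻¹ * (q ^ (1 + α)) ^ n := by
      ext n
      simp only [hU, Int.natCast_nonneg, if_true, Int.cast_natCast, mul_one]
      rw [mul_comm (n:ℝ), Real.rpow_mul hq.le, Real.rpow_natCast]
    rw [this]
    exact (summable_geometric_of_lt_one (by positivity) (Real.rpow_lt_one hq.le hq1 (by linarith))).mul_left _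
  · have h : Summable (fun n : ℕ => 2 * ρ⁻¹ * (ρ ^ 2 - q ^ 2)⁻¹ * (q ^ (1 - α)) ^ n) :=
      (summable_geometric_of_lt_one (by positivity) (Real.rpow_lt_one hq.le hq1 (by linarith))).mul_left _
    have : (fun n : ℕ => hU q α ρ (-n)) = fun n : ℕ => 2 * ρ⁻¹ * (ρ ^ 2 - q ^ 2)⁻¹ * (q ^ (1 - α)) ^ n := by
      ext n
      rcases Nat.eq_zero_or_pos n with rfl | hn
      · simp [hU]
      · have : ¬ (0 ≤ -(n:ℤ)) := by omega
        simp only [hU, this, if_false]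
        rw [mul_assoc, ← Real.rpow_add hq, ← Real.rpow_natCast (q ^ (1 - α)), ← Real.rpow_mul hq.le]
        congr 2; push_cast; ring
    rw [this]; exact h

lemma zn_bound {q ρ : ℝ} (hq : 0 < q) (hq1 : q < 1) (hρ1 : q < ρ) (k : ℤ) (hk : k ≠ 0)
    (z : ℂ) (h1 : ρ < ‖z‖) (h2 : ‖z‖ < ρ⁻¹) :
    (ρ ^ 2 - q ^ 2) ≤ ‖z ^ 2 - (q : ℂ) ^ (2 * k)‖ * (if 0 ≤ k then 1 else q ^ (-2 * (k:ℝ))) := by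
  have hρ : 0 < ρ := hq.trans hρ1
  have hnq : ‖(q : ℂ) ^ (2 * k)‖ = q ^ (2 * k) := by
    rw [norm_zpow, norm_real, Real.norm_of_nonneg hq.le]
  split_ifs with h
  · have hk1 : q ^ (2 * k) ≤ q ^ 2 := by
      have : q ^ (2 * k) ≤ q ^ (2 : ℤ) := zpow_le_zpow_right_of_le_one₀ hq hq1.le (by omega)
      exact_mod_cast this
    have := norm_sub_norm_le (z ^ 2) ((q : ℂ) ^ (2 * k))
    rw [hnq, norm_pow] at this
    nlinarith
  · have e : q ^ (-2 * (k:ℝ)) = (q ^ (2 * k))⁻¹ := by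
      rw [← zpow_neg, ← Real.rpow_intCast]; congr 1; push_cast; ring
    rw [e]
    have hp : 0 < q ^ (2 * k) := by positivity
    rw [← div_eq_mul_inv, le_div_iff₀ hp]
    have hk1 : (q ^ 2)⁻¹ ≤ q ^ (2 * k) := by
      have : q ^ (-2 : ℤ) ≤ q ^ (2 * k) := zpow_le_zpow_right_of_le_one₀ hq hq1.le (by omega)
      rw [zpow_neg] at this
      exact_mod_cast this
    have := norm_sub_norm_le ((q : ℂ) ^ (2 * k)) (z ^ 2)
    rw [hnq, norm_pow, norm_sub_rev] at this
    have hz2 : ‖z‖ ^ 2 ≤ (ρ ^ 2)⁻¹ := by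
      rw [← inv_pow]; gcongr
    set X := q ^ (2 * k)
    have h3 : 1 ≤ q ^ 2 * X := by
      have := mul_le_mul_of_nonneg_left hk1 (sq_nonneg q)
      rwa [mul_inv_cancel₀ (by positivity)] at this
    -- (ρ²-q²) X ≤ X - ρ⁻²
    have hρ1' : ρ < 1 := by
      have : ρ < ρ⁻¹ := h1.trans h2
      by_contra hh
      have : ρ⁻¹ ≤ 1 := inv_le_one_of_one_le₀ (by linarith)
      linarith
    have hY : (ρ ^ 2)⁻¹ * ρ ^ 2 = 1 := inv_mul_cancel₀ (by positivity)
    set Y := (ρ ^ 2)⁻¹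
    have hY0 : 0 < Y := by positivity
    have hY1 : 1 ≤ Y := (one_le_inv₀ (by positivity)).2 (by nlinarith)
    have hXY : Y ≤ X := by
      have : q ^ 2 ≤ ρ ^ 2 := by gcongr
      refine le_trans ?_ hk1
      exact inv_anti₀ (by positivity) this
    -- X(1-ρ²+q²) ≥ Y
    have : Y ≤ X * (1 - ρ ^ 2 + q ^ 2) := by
      nlinarith [mul_le_mul_of_nonneg_right hXY (show 0 ≤ 1 - ρ ^ 2 by nlinarith)]
    nlinarith

lemma hT_bound {q α ρ : ℝ} (hq : 0 < q) (hq1 : q < 1) (hρ1 : q < ρ) (k : ℤ) (hk : k ≠ 0)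
    (z : ℂ) (h1 : ρ < ‖z‖) (h2 : ‖z‖ < ρ⁻¹) : ‖hT q α k z‖ ≤ hU q α ρ k := by
  have hb := zn_bound hq hq1 hρ1 k hk z h1 h2
  have hpos : 0 < ρ ^ 2 - q ^ 2 := by nlinarith
  set W := (if 0 ≤ k then (1:ℝ) else q ^ (-2 * (k:ℝ))) with hW
  have hW0 : 0 < W := by rw [hW]; split_ifs <;> positivity
  have hN : 0 < ‖z ^ 2 - (q : ℂ) ^ (2 * k)‖ := by
    by_contra hh
    have : ‖z ^ 2 - (q : ℂ) ^ (2 * k)‖ = 0 := le_antisymm (not_lt.1 hh) (norm_nonneg _)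
    rw [this] at hb; linarith
  rw [hT, hU, ← hW, norm_div, norm_mul, norm_mul, norm_real, Real.norm_of_nonneg (by positivity)]
  rw [div_le_iff₀ hN]
  have e : 1 ≤ (ρ ^ 2 - q ^ 2)⁻¹ * (‖z ^ 2 - (q : ℂ) ^ (2 * k)‖ * W) := by
    rw [← div_eq_inv_mul, le_div_iff₀ hpos]; linarith
  have hρ : 0 < ρ := hq.trans hρ1
  calc ‖(2:ℂ)‖ * ‖z‖ * q ^ ((k:ℝ) * (1 + α)) ≤ 2 * ρ⁻¹ * q ^ ((k:ℝ) * (1 + α)) * 1 := by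
        rw [mul_one, Complex.norm_ofNat]; gcongr
    _ ≤ 2 * ρ⁻¹ * q ^ ((k:ℝ) * (1 + α)) * ((ρ ^ 2 - q ^ 2)⁻¹ * (‖z ^ 2 - (q : ℂ) ^ (2 * k)‖ * W)) := by
        gcongr
    _ = _ := by ring

/-- Regular part of `h`. -/
noncomputable def hR (q α : ℝ) (z : ℂ) : ℂ := ∑' k : ℤ, if k = 0 then 0 else hT q α k z

lemma hU_nonneg {q α ρ : ℝ} (hq : 0 < q) (hρ1 : q < ρ) (k : ℤ) : 0 ≤ hU q α ρ k := by
  have hρ : 0 < ρ := hq.trans hρ1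
  have hpos : 0 < ρ ^ 2 - q ^ 2 := by nlinarith
  rw [hU]; split_ifs <;> positivity

lemma hR_bound {q α ρ : ℝ} (hq : 0 < q) (hq1 : q < 1) (hρ1 : q < ρ) (k : ℤ)
    (z : ℂ) (h1 : ρ < ‖z‖) (h2 : ‖z‖ < ρ⁻¹) : ‖if k = 0 then 0 else hT q α k z‖ ≤ hU q α ρ k := by
  split_ifs with h
  · rw [norm_zero]; exact hU_nonneg hq hρ1 k
  · exact hT_bound hq hq1 hρ1 k h z h1 h2

lemma h_split {q α ρ : ℝ} (hq : 0 < q) (hq1 : q < 1) (hα1 : -1 < α) (hα2 : α < 1)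
    (hρ1 : q < ρ) (z : ℂ) (h1 : ρ < ‖z‖) (h2 : ‖z‖ < ρ⁻¹) :
    hAlpha q α z = 2 * z / (z ^ 2 - 1) + hR q α z := by
  have hs : Summable (fun k : ℤ => if k = 0 then 0 else hT q α k z) :=
    (hU_summable (ρ := ρ) hq hq1 hα1 hα2).of_norm_bounded (fun k => hR_bound hq hq1 hρ1 k z h1 h2)
  have hs2 : Summable (fun k : ℤ => hT q α k z) := by
    refine (hs.add (summable_of_hasFiniteSupport (f := fun k : ℤ => if k = 0 then hT q α k z else 0) ?_)).congr ?_
    · refine (Set.finite_singleton (0:ℤ)).subset ?_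
      intro k hk
      simp only [Function.mem_support] at hk
      by_contra h
      exact hk (if_neg h)
    · intro k; split_ifs <;> simp
  have := hs2.tsum_eq_add_tsum_ite 0
  rw [hAlpha, hR]
  refine this.trans ?_
  simp [hT]

lemma hR_diff {q α ρ : ℝ} (hq : 0 < q) (hq1 : q < 1) (hα1 : -1 < α) (hα2 : α < 1)
    (hρ1 : q < ρ) (z : ℂ) (h1 : ρ < ‖z‖) (h2 : ‖z‖ < ρ⁻¹) : DifferentiableAt ℂ (hR q α) z := by
  have ho : IsOpen {z : ℂ | ρ < ‖z‖ ∧ ‖z‖ < ρ⁻¹} :=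
    (isOpen_lt continuous_const continuous_norm).inter (isOpen_lt continuous_norm continuous_const)
  have := Complex.differentiableOn_tsum_of_summable_norm (F := fun (k : ℤ) (z : ℂ) => if k = 0 then 0 else hT q α k z)
    (hU_summable (ρ := ρ) hq hq1 hα1 hα2) (U := {z : ℂ | ρ < ‖z‖ ∧ ‖z‖ < ρ⁻¹}) (by
      intro k z hz
      by_cases hk : k = 0
      · simp only [hk, if_true]; exact differentiableWithinAt_const _
      · simp only [hk, if_false]
        apply DifferentiableAt.differentiableWithinAt
        have hb := zn_bound hq hq1 hρ1 k hk z hz.1 hz.2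
        have : z ^ 2 - (q : ℂ) ^ (2 * k) ≠ 0 := by
          intro h
          rw [h] at hb
          have hpos : 0 < ρ ^ 2 - q ^ 2 := by nlinarith
          simp at hb
          nlinarith
        unfold hT
        fun_prop (disch := exact this)) ho (fun k z hz => hR_bound hq hq1 hρ1 k z hz.1 hz.2)
  exact this.differentiableAt (ho.mem_nhds ⟨h1, h2⟩)

lemma hR_neg (q α : ℝ) (z : ℂ) : hR q α (-z) = -hR q α z := by
  rw [hR, hR, ← tsum_neg]
  congr 1; ext k
  split_ifs
  · simp
  · rw [hT, hT, neg_sq]; ring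

lemma ser_diff (c : ℕ → ℂ) (e : ℕ → ℤ) (he : ∀ j, 0 ≤ e j) (f : ℂ → ℂ)
    (hf : ∀ t : ℂ, t ≠ 0 → HasSum (fun j : ℕ => c j * t ^ (-(e j))) (f t))
    (hs : ∀ t : ℂ, t ≠ 0 → Summable (fun j : ℕ => ‖c j * t ^ (-(e j))‖))
    (z : ℂ) (hz : z ≠ 0) : DifferentiableAt ℂ f z := by
  have hz0 : 0 < ‖z‖ := norm_pos_iff.2 hz
  set r : ℝ := ‖z‖ / 2 with hr
  have hr0 : 0 < r := by positivity
  have ho : IsOpen {w : ℂ | r < ‖w‖} := isOpen_lt continuous_const continuous_norm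
  have hne : ∀ w : ℂ, r < ‖w‖ → w ≠ 0 := fun w hw => norm_pos_iff.1 (hr0.trans hw)
  have h := Complex.differentiableOn_tsum_of_summable_norm (F := fun (j : ℕ) (w : ℂ) => c j * w ^ (-(e j)))
    (hs (r : ℂ) (by exact_mod_cast hr0.ne')) (U := {w : ℂ | r < ‖w‖})
    (fun j w hw => ((differentiableAt_zpow.2 (Or.inl (hne w hw))).const_mul _).differentiableWithinAt) ho
    (fun j w hw => by
      have hw' : r < ‖w‖ := hw
      rw [norm_mul, norm_mul, norm_zpow, norm_zpow, norm_real, Real.norm_of_nonneg hr0.le,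
        zpow_neg, zpow_neg]
      gcongr
      exact zpow_le_zpow_left₀ (he j) hr0.le hw'.le)
  have h2 : DifferentiableOn ℂ f {w : ℂ | r < ‖w‖} :=
    h.congr (fun w hw => (hf w (hne w hw)).tsum_eq.symm)
  exact h2.differentiableAt (ho.mem_nhds (by show ‖z‖ / 2 < ‖z‖; linarith))

lemma orbit {q : ℝ} (hq : 0 < q) (Q : ℂ → Prop) (hQ : ∀ t : ℂ, t ≠ 0 → (Q (q * t) ↔ Q t))
    (n : ℤ) (t : ℂ) (ht : t ≠ 0) : Q ((q : ℂ) ^ n * t) ↔ Q t := by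
  have hqc : (q : ℂ) ≠ 0 := by exact_mod_cast hq.ne'
  induction n using Int.induction_on with
  | zero => simp
  | succ i ih =>
    refine Iff.trans ?_ ih
    rw [← hQ _ (mul_ne_zero (zpow_ne_zero (i : ℤ) hqc) ht), ← mul_assoc, ← zpow_one_add₀ hqc, add_comm]
  | pred i ih =>
    refine Iff.trans ?_ ih
    rw [← hQ _ (mul_ne_zero (zpow_ne_zero (-(i : ℤ) - 1) hqc) ht), ← mul_assoc, ← zpow_one_add₀ hqc]
    have : 1 + (-(i:ℤ) - 1) = -i := by ring
    rw [this]

lemma orbit_exists {q : ℝ} (hq : 0 < q) (hq1 : q < 1) (t : ℂ) (ht : t ≠ 0) :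
    ∃ n : ℤ, √q ≤ ‖(q : ℂ) ^ n * t‖ ∧ ‖(q : ℂ) ^ n * t‖ ≤ (√q)⁻¹ := by
  have hs : 0 < √q := Real.sqrt_pos.2 hq
  have ht0 : 0 < ‖t‖ := norm_pos_iff.2 ht
  obtain ⟨n, hn1, hn2⟩ := exists_mem_Ico_zpow (x := ‖t‖ / √q) (y := q⁻¹) (by positivity)
    ((one_lt_inv₀ hq).2 hq1)
  refine ⟨n, ?_⟩
  rw [norm_mul, norm_zpow, norm_real, Real.norm_of_nonneg hq.le]
  rw [inv_zpow] at hn1 hn2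
  have hqn : 0 < q ^ n := by positivity
  have hss : √q * √q = q := Real.mul_self_sqrt hq.le
  constructor
  · rw [le_div_iff₀ hs] at hn1
    calc √q = q ^ n * ((q ^ n)⁻¹ * √q) := by field_simp
      _ ≤ _ := by gcongr
  · rw [div_lt_iff₀ hs, zpow_add_one₀ hq.ne'] at hn2
    calc q ^ n * ‖t‖ ≤ q ^ n * ((q ^ n * q)⁻¹ * √q) := by gcongr
      _ = √q / q := by field_simp
      _ = (√q)⁻¹ := by
        rw [div_eq_iff hq.ne', ← hss]; field_simp; simp [hss]

end Aux

open Complex Metric Set Filter Topology in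
/-- the connection formula `S_C(t) = λ g(t) h^α(t) S_A(t) + μ g(t) S_B(t)`. -/
theorem statement14 (q α : ℝ) (hq0 : 0 < q) (hq1 : q < 1)
    (hα1 : -1 < α) (hα2 : α < 1) (hodd : ∀ j : ℕ, α ≠ 2 * (j : ℝ) + 1)
    (uA vA uB vB : ℂ → ℂ)
    (hA : Differentiable ℂ uA ∧ Differentiable ℂ vA ∧
      (∀ t : ℂ, uA (-t) = uA t) ∧ (∀ t : ℂ, vA (-t) = -vA t) ∧ uA 0 = 1 ∧
      ∀ t : ℂ,
        uA ((q : ℂ) * t) = uA t - t * vA t ∧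
        vA ((q : ℂ) * t) = t * ((q ^ (2 - α) : ℝ) : ℂ) * uA t +
          (((q ^ (-α) : ℝ) : ℂ) - t ^ 2 * ((q ^ (2 - α) : ℝ) : ℂ)) * vA t)
    (hB : Differentiable ℂ uB ∧ Differentiable ℂ vB ∧
      (∀ t : ℂ, uB (-t) = -uB t) ∧ (∀ t : ℂ, vB (-t) = vB t) ∧ vB 0 = 1 ∧
      ∀ t : ℂ,
        uB ((q : ℂ) * t) = ((q ^ α : ℝ) : ℂ) * uB t - t * ((q ^ α : ℝ) : ℂ) * vB t ∧
        vB ((q : ℂ) * t) = t * (q : ℂ) ^ 2 * uB t + (1 - t ^ 2 * (q : ℂ) ^ 2) * vB t)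
    (c d : ℕ → ℂ) (uC vC : ℂ → ℂ) (hd0 : d 0 = 1)
    (huC : ∀ t : ℂ, t ≠ 0 →
      HasSum (fun j : ℕ => c j * t ^ (-(2 * (j : ℤ) + 1))) (uC t))
    (hvC : ∀ t : ℂ, t ≠ 0 →
      HasSum (fun l : ℕ => d l * t ^ (-(2 * (l : ℤ)))) (vC t))
    (hCsum : ∀ t : ℂ, t ≠ 0 →
      Summable (fun j : ℕ => ‖c j * t ^ (-(2 * (j : ℤ) + 1))‖) ∧
      Summable (fun l : ℕ => ‖d l * t ^ (-(2 * (l : ℤ)))‖))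
    (hCeq : ∀ t : ℂ, t ≠ 0 →
      uC ((q : ℂ) * t) = (-1 / ((q : ℂ) ^ 2 * t ^ 2)) *
        (((q ^ α : ℝ) : ℂ) * uC t - t * ((q ^ α : ℝ) : ℂ) * vC t) ∧
      vC ((q : ℂ) * t) = (-1 / ((q : ℂ) ^ 2 * t ^ 2)) *
        (t * (q : ℂ) ^ 2 * uC t + (1 - t ^ 2 * (q : ℂ) ^ 2) * vC t)) :
    ∃ lam mu : ℂ, ∀ t : ℂ, t ≠ 0 → (∀ k : ℤ, t ≠ (q : ℂ) ^ k ∧ t ≠ -((q : ℂ) ^ k)) →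
      uC t = lam * gFun q t * hAlpha q α t * uA t + mu * gFun q t * uB t ∧
      vC t = lam * gFun q t * hAlpha q α t * vA t + mu * gFun q t * vB t := by
  obtain ⟨hAd, hAd', hAe, hAo, hA0, hAeq⟩ := hA
  obtain ⟨hBd, hBd', hBo, hBe, hB0, hBeq⟩ := hB
  have hqc : (q : ℂ) ≠ 0 := by exact_mod_cast hq0.ne'
  have hs : 0 < √q := Real.sqrt_pos.2 hq0
  have hs1 : √q < 1 := by rw [Real.sqrt_lt' one_pos]; simpa
  have hss : √q * √q = q := Real.mul_self_sqrt hq0.le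
  have hqs : q < √q := by nlinarith
  obtain ⟨ρ, hρ1, hρ2⟩ := exists_between hqs
  have hρ : 0 < ρ := hq0.trans hρ1
  have hsr : (√q)⁻¹ < ρ⁻¹ := (inv_lt_inv₀ hs hρ).2 hρ2
  have hsi : 1 < (√q)⁻¹ := (one_lt_inv₀ hs).2 hs1
  have hqsi : q * (√q)⁻¹ = √q := by rw [← div_eq_mul_inv, Real.div_sqrt]
  set K : ℂ := ((q ^ α : ℝ) : ℂ) with hK
  have hK0 : K ≠ 0 := by
    have : 0 < q ^ α := by positivity
    rw [hK]; exact_mod_cast this.ne'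
  have e1 : ((q ^ (-α) : ℝ) : ℂ) = K⁻¹ := by rw [hK, Real.rpow_neg hq0.le]; push_cast; rfl
  have e2 : ((q ^ (2 - α) : ℝ) : ℂ) = (q : ℂ) ^ 2 * K⁻¹ := by
    rw [← e1, sub_eq_add_neg, Real.rpow_add hq0]; push_cast; simp
  simp only [e1, e2] at hAeq
  have hne : ∀ z : ℂ, ρ < ‖z‖ → z ≠ 0 := fun z hz => norm_pos_iff.1 (hρ.trans hz)
  -- differentiability and parity of C
  have huCd : ∀ z : ℂ, z ≠ 0 → DifferentiableAt ℂ uC z :=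
    ser_diff c (fun j => 2 * (j : ℤ) + 1) (fun j => by positivity) uC huC (fun t ht => (hCsum t ht).1)
  have hvCd : ∀ z : ℂ, z ≠ 0 → DifferentiableAt ℂ vC z :=
    ser_diff d (fun j => 2 * (j : ℤ)) (fun j => by positivity) vC hvC (fun t ht => (hCsum t ht).2)
  have huCo : ∀ z : ℂ, z ≠ 0 → uC (-z) = -uC z := by
    intro z hz
    refine (huC (-z) (neg_ne_zero.2 hz)).unique ?_
    refine (huC z hz).neg.congr_fun ?_
    intro j
    have : Odd (-(2 * (j : ℤ) + 1)) := Odd.neg ⟨j, rfl⟩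
    rw [this.neg_zpow]; ring
  have hvCe : ∀ z : ℂ, z ≠ 0 → vC (-z) = vC z := by
    intro z hz
    refine (hvC (-z) (neg_ne_zero.2 hz)).unique ?_
    refine (hvC z hz).congr_fun ?_
    intro j
    have : Even (-(2 * (j : ℤ))) := Even.neg ⟨j, by ring⟩
    rw [this.neg_zpow]
  -- Wronskian
  have hvA0 : vA 0 = 0 := by
    have := hAo 0
    rw [neg_zero] at this
    exact self_eq_neg.1 this
  have hW : ∀ t, uA t * vB t - uB t * vA t = 1 := by
    intro t
    set W : ℂ → ℂ := fun t => uA t * vB t - uB t * vA t with hWdef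
    have hstep : ∀ t, W (q * t) = W t := by
      intro t
      simp only [hWdef]
      rw [(hAeq t).1, (hAeq t).2, (hBeq t).1, (hBeq t).2]
      field_simp
      ring
    have hit : ∀ n : ℕ, W ((q : ℂ) ^ n * t) = W t := by
      intro n
      induction n with
      | zero => simp
      | succ n ih => rw [pow_succ', mul_assoc, hstep, ih]
    have hWc : Continuous W :=
      (hAd.continuous.mul hBd'.continuous).sub (hBd.continuous.mul hAd'.continuous)
    have hlim : Tendsto (fun n : ℕ => (q : ℂ) ^ n * t) atTop (𝓝 0) := by
      have h := tendsto_pow_atTop_nhds_zero_of_norm_lt_one (x := (q : ℂ))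
        (by rw [norm_real, Real.norm_of_nonneg hq0.le]; exact hq1)
      simpa using h.mul_const t
    have h1 := (hWc.tendsto 0).comp hlim
    have h2 : (W ∘ fun n : ℕ => (q : ℂ) ^ n * t) = fun _ => W t := funext hit
    rw [h2] at h1
    have h3 := tendsto_nhds_unique tendsto_const_nhds h1
    show W t = 1
    rw [h3]
    simp [hWdef, hA0, hB0, hvA0]
  -- b
  have hb_feq : ∀ t : ℂ, t ≠ 0 → uA (q * t) * vC (q * t) - vA (q * t) * uC (q * t) =
      (-1 / ((q : ℂ) ^ 2 * t ^ 2)) * (uA t * vC t - vA t * uC t) := by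
    intro t ht
    rw [(hAeq t).1, (hAeq t).2, (hCeq t ht).1, (hCeq t ht).2]
    field_simp
    ring
  have ha_feq : ∀ t : ℂ, t ≠ 0 → uC (q * t) * vB (q * t) - vC (q * t) * uB (q * t) =
      (-1 / ((q : ℂ) ^ 2 * t ^ 2)) * K * (uC t * vB t - vC t * uB t) := by
    intro t ht
    rw [(hBeq t).1, (hBeq t).2, (hCeq t ht).1, (hCeq t ht).2]
    field_simp
    ring
  have hPd := Pq_diff hq0 hq1
  have hPd1 : ∀ z : ℂ, z ≠ 0 → DifferentiableAt ℂ (fun z : ℂ => Pq q (z ^ 2)) z := by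
    intro z hz
    exact (hPd (z ^ 2)).comp z (f := fun z : ℂ => z ^ 2) (by fun_prop)
  have hinvd : ∀ z : ℂ, z ≠ 0 → DifferentiableAt ℂ (fun z : ℂ => (z ^ 2)⁻¹) z := by
    intro z hz
    exact DifferentiableAt.inv (by fun_prop) (pow_ne_zero 2 hz)
  have hPd2 : ∀ z : ℂ, z ≠ 0 → DifferentiableAt ℂ (fun z : ℂ => Pq q (z ^ 2)⁻¹) z := by
    intro z hz
    exact (hPd _).comp z (f := fun z : ℂ => (z ^ 2)⁻¹) (hinvd z hz)
  have hgd : ∀ z : ℂ, z ≠ 0 → DifferentiableAt ℂ (gFun q) z := by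
    intro z hz
    have : gFun q = fun z => Pq q (z ^ 2) * ((1 - (z ^ 2)⁻¹) * Pq q ((z ^ 2)⁻¹)) :=
      funext (g_eq hq0 hq1)
    rw [this]
    exact (hPd1 z hz).mul (((differentiableAt_const _).sub (hinvd z hz)).mul (hPd2 z hz))
  have hring : ∀ z : ℂ, ‖z‖ = (√q)⁻¹ → z ≠ 0 := by
    intro z hz
    rw [← norm_pos_iff, hz]; positivity
  have hSb : Sp q ρ (-1 / (q : ℂ) ^ 2) (fun t => uA t * vC t - vA t * uC t) := by
    refine ⟨fun z h1 _ => ?_, fun z h1 _ => ?_, fun z hz => ?_⟩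
    · exact ((hAd z).mul (hvCd z (hne z h1))).sub ((hAd' z).mul (huCd z (hne z h1)))
    · simp only [hAe, hAo, hvCe z (hne z h1), huCo z (hne z h1)]; ring
    · have h0 := hring z hz
      simp only [hb_feq z h0]
      field_simp
  have hSg : Sp q ρ (-1 / (q : ℂ) ^ 2) (gFun q) := by
    refine ⟨fun z h1 _ => hgd z (hne z h1), fun z h1 _ => g_neg q z, fun z hz => ?_⟩
    have h0 := hring z hz
    simp only [g_feq hq0 hq1 z h0]
    field_simp
  obtain ⟨mu, hmu⟩ := Sp.dep hq0 hq1 hρ hρ2 (div_ne_zero (by norm_num) (pow_ne_zero 2 hqc)) hSb hSg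
    I (by simp) (by
      rw [g_eq hq0 hq1]
      have : ((-1 : ℂ))⁻¹ = -1 := by norm_num
      rw [I_sq, this]
      have := Pq_neg_one hq0 hq1
      norm_num [this])
  -- a
  set F2 : ℂ → ℂ := fun z => z * (gFun q z * hR q α z +
    2 * z * (z ^ 2)⁻¹ * (Pq q (z ^ 2) * Pq q (z ^ 2)⁻¹)) with hF2
  have hF2eq : ∀ z : ℂ, ρ < ‖z‖ → ‖z‖ < ρ⁻¹ → z ^ 2 ≠ 1 → F2 z = z * (gFun q z * hAlpha q α z) := by
    intro z h1 h2 h3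
    have h0 := hne z h1
    have h4 : z ^ 2 - 1 ≠ 0 := sub_ne_zero.2 h3
    simp only [hF2]
    rw [h_split hq0 hq1 hα1 hα2 hρ1 z h1 h2, mul_add, g_eq hq0 hq1]
    field_simp
    ring
  have hsq : ∀ z : ℂ, ‖z‖ ≠ 1 → z ^ 2 ≠ 1 := by
    intro z hz h
    apply hz
    have : ‖z‖ ^ 2 = 1 := by rw [← norm_pow, h, norm_one]
    exact (pow_eq_one_iff_of_nonneg (norm_nonneg _) two_ne_zero).1 this
  have hSF2 : Sp q ρ (-K / q) F2 := by
    refine ⟨fun z h1 h2 => ?_, fun z h1 _ => ?_, fun z hz => ?_⟩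
    · have h0 := hne z h1
      refine differentiableAt_id.mul (((hgd z h0).mul (hR_diff hq0 hq1 hα1 hα2 hρ1 z h1 h2)).add ?_)
      exact (((differentiableAt_id.const_mul 2)).mul (hinvd z h0)).mul ((hPd1 z h0).mul (hPd2 z h0))
    · simp only [hF2, g_neg, hR_neg, neg_sq]; ring
    · have h0 := hring z hz
      have hqz : ‖(q : ℂ) * z‖ = √q := by
        rw [norm_mul, norm_real, Real.norm_of_nonneg hq0.le, hz, hqsi]
      rw [hF2eq (q * z) (by rw [hqz]; exact hρ2) (by rw [hqz]; linarith) (hsq _ (by rw [hqz]; exact hs1.ne)),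
        hF2eq z (by rw [hz]; linarith) (by rw [hz]; exact hsr) (hsq _ (by rw [hz]; exact hsi.ne')),
        g_feq hq0 hq1 z h0, h_feq α hq0, ← hK]
      field_simp
  have hSa : Sp q ρ (-K / q) (fun t => t * (uC t * vB t - vC t * uB t)) := by
    refine ⟨fun z h1 _ => ?_, fun z h1 _ => ?_, fun z hz => ?_⟩
    · exact differentiableAt_id.mul
        (((huCd z (hne z h1)).mul (hBd' z)).sub ((hvCd z (hne z h1)).mul (hBd z)))
    · simp only [hBe, hBo, hvCe z (hne z h1), huCo z (hne z h1)]; ring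
    · have h0 := hring z hz
      simp only [ha_feq z h0]
      field_simp
  obtain ⟨lam, hlam⟩ := Sp.dep hq0 hq1 hρ hρ2 (div_ne_zero (neg_ne_zero.2 hK0) hqc) hSa hSF2
    1 (by simp) (by
      simp only [hF2]
      rw [g_eq hq0 hq1]
      have := Pq_one hq0 hq1
      simp [this])
  refine ⟨lam, mu, fun t ht hpole => ?_⟩
  obtain ⟨n, hn1, hn2⟩ := orbit_exists hq0 hq1 t ht
  have hr1 : ρ < ‖(q : ℂ) ^ n * t‖ := lt_of_lt_of_le hρ2 hn1
  have hr2 : ‖(q : ℂ) ^ n * t‖ < ρ⁻¹ := lt_of_le_of_lt hn2 hsr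
  have hb : uA t * vC t - vA t * uC t = mu * gFun q t := by
    refine (orbit hq0 (fun t => uA t * vC t - vA t * uC t = mu * gFun q t) ?_ n t ht).1 (hmu _ hr1 hr2)
    intro t ht
    rw [hb_feq t ht, g_feq hq0 hq1 t ht, mul_left_comm mu]
    exact mul_right_inj' (div_ne_zero (by norm_num)
      (mul_ne_zero (pow_ne_zero 2 hqc) (pow_ne_zero 2 ht)))
  have ha : uC t * vB t - vC t * uB t = lam * (gFun q t * hAlpha q α t) := by
    refine (orbit hq0 (fun t => uC t * vB t - vC t * uB t = lam * (gFun q t * hAlpha q α t)) ?_ n t ht).1 ?_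
    · intro t ht
      rw [ha_feq t ht, g_feq hq0 hq1 t ht, h_feq α hq0]
      have : lam * (-1 / ((q : ℂ) ^ 2 * t ^ 2) * gFun q t * (((q ^ α : ℝ) : ℂ) * hAlpha q α t)) =
        -1 / ((q : ℂ) ^ 2 * t ^ 2) * K * (lam * (gFun q t * hAlpha q α t)) := by ring
      rw [this]
      exact mul_right_inj' (mul_ne_zero (div_ne_zero (by norm_num)
        (mul_ne_zero (pow_ne_zero 2 hqc) (pow_ne_zero 2 ht))) hK0)
    · have hz0 := hne _ hr1
      have hz1 : ((q : ℂ) ^ n * t) ^ 2 ≠ 1 := by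
        intro h
        have hqn : (q : ℂ) ^ n ≠ 0 := zpow_ne_zero _ hqc
        rcases sq_eq_sq_iff_eq_or_eq_neg.1 (h.trans (one_pow 2).symm) with h | h
        · exact (hpole (-n)).1 (by rw [zpow_neg]; exact eq_inv_of_mul_eq_one_right h)
        · refine (hpole (-n)).2 ?_
          rw [zpow_neg]
          field_simp
          linear_combination h
      have := hlam _ hr1 hr2
      rw [hF2eq _ hr1 hr2 hz1] at this
      apply mul_left_cancel₀ hz0
      rw [this]; ring
  have hWt := hW t
  constructor
  · linear_combination (-uC t) * hWt + uA t * ha + uB t * hb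
  · linear_combination (-vC t) * hWt + vA t * ha + vB t * hb
end

section
/- Let C be analytic on ℂ ∖ ({0} ∪ {q^k : k ∈ ℤ} ∪ {−q^k : k ∈ ℤ}) such that at each point ±q^k (k ∈ ℤ) C has at worst a simple pole (i.e. (z ∓ q^k)·C(z) is bounded near ±q^k), and suppose C(qz) = C(z) for all z in its domain. Then there exist constants c₀, c₁ ∈ ℂ such that C(z) = c₁ h⁰(z) + c₀ for all z in the domain, where h⁰(z) = Σ_{k=−∞}^∞ 2 z q^k / (z² − q^{2k}). -/
/-- The function `h⁰(z) = Σ_{k=-∞}^∞ 2 z q^k / (z² - q^{2k})`. -/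
noncomputable def hZero (q : ℝ) (z : ℂ) : ℂ :=
  ∑' k : ℤ, 2 * z * (q : ℂ) ^ k / (z ^ 2 - (q : ℂ) ^ (2 * k))

namespace QEll

open Filter Topology Set Metric

def Dom (q : ℝ) (z : ℂ) : Prop := z ≠ 0 ∧ ∀ k : ℤ, z ≠ (q : ℂ) ^ k ∧ z ≠ -((q : ℂ) ^ k)

def Ann (r : ℝ) : Set ℂ := {z : ℂ | r < ‖z‖ ∧ ‖z‖ < r⁻¹}

lemma isOpen_ann (r : ℝ) : IsOpen (Ann r) :=
  (isOpen_lt continuous_const continuous_norm).inter (isOpen_lt continuous_norm continuous_const)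

lemma preconn_ann {r : ℝ} (hr : 0 < r) : IsPreconnected (Ann r) := by
  have h : Ann r = Complex.exp '' {w : ℂ | Real.log r < w.re ∧ w.re < Real.log r⁻¹} := by
    ext z
    constructor
    · rintro ⟨h1, h2⟩
      have hz : z ≠ 0 := by
        rintro rfl
        simp at h1
        linarith
      refine ⟨Complex.log z, ?_, Complex.exp_log hz⟩
      simp only [mem_ofPred_eq, Complex.log_re]
      exact ⟨Real.log_lt_log hr h1, Real.log_lt_log (norm_pos_iff.2 hz) h2⟩
    · rintro ⟨w, ⟨h1, h2⟩, rfl⟩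
      simp only [Ann, mem_ofPred_eq, Complex.norm_exp]
      exact ⟨(Real.log_lt_iff_lt_exp hr).1 h1, (Real.lt_log_iff_exp_lt (inv_pos.2 hr)).1 h2⟩
  rw [h]
  refine IsPreconnected.image ?_ _ Complex.continuous_exp.continuousOn
  have hc : Convex ℝ {w : ℂ | Real.log r < w.re ∧ w.re < Real.log r⁻¹} :=
    (convex_halfSpace_re_gt _).inter (convex_halfSpace_re_lt _)
  exact hc.isPreconnected

lemma one_step {A : Set ℂ} {c : ℂ} (hA : A ∈ 𝓝 c) {f : ℂ → ℂ}
    (hf : DifferentiableOn ℂ f (A \ {c})) {M : ℝ}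
    (hM : ∀ᶠ z in 𝓝[≠] c, ‖(z - c) * f z‖ ≤ M) :
    ∃ (a : ℂ) (G : ℂ → ℂ), DifferentiableOn ℂ G A ∧
      ∀ z ∈ A, z ≠ c → f z = a / (z - c) + G z := by
  set F : ℂ → ℂ := Function.update (fun z => (z - c) * f z) c
    (limUnder (𝓝[≠] c) (fun z => (z - c) * f z)) with hF
  have hFd : DifferentiableOn ℂ F A := by
    apply Complex.differentiableOn_update_limUnder_of_isLittleO hA
    · exact (differentiableOn_id.sub_const c).mul hf
    · apply IsBoundedUnder.isLittleO_sub_self_inv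
      refine ⟨M, ?_⟩
      rw [eventually_map]
      filter_upwards [hM] with z hz
      simpa using hz
  refine ⟨F c, dslope F c, (Complex.differentiableOn_dslope hA).2 hFd, ?_⟩
  intro z hz hzc
  have h1 : F z = (z - c) * f z := by simp [hF, Function.update_of_ne hzc]
  rw [dslope_of_ne _ hzc, slope_def_field, h1]
  have : z - c ≠ 0 := sub_ne_zero.2 hzc
  field_simp
  ring

lemma decomp {A : Set ℂ} (hAo : IsOpen A) (h1 : (1 : ℂ) ∈ A) (h2 : (-1 : ℂ) ∈ A) {f : ℂ → ℂ}
    (hf : DifferentiableOn ℂ f (A \ {1, -1})) {M N : ℝ}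
    (hM : ∀ᶠ z in 𝓝[≠] (1 : ℂ), ‖(z - 1) * f z‖ ≤ M)
    (hN : ∀ᶠ z in 𝓝[≠] (-1 : ℂ), ‖(z + 1) * f z‖ ≤ N) :
    ∃ (a b : ℂ) (G : ℂ → ℂ), DifferentiableOn ℂ G A ∧
      ∀ z ∈ A, z ≠ 1 → z ≠ -1 → f z = a / (z - 1) + b / (z + 1) + G z := by
  have hne : (1 : ℂ) ≠ -1 := by norm_num [Complex.ext_iff]
  have hopen : IsOpen (A \ {-1}) := hAo.sdiff isClosed_singleton
  obtain ⟨b, G, hG, hfG⟩ := one_step (A := A \ {1}) (c := -1)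
    ((hAo.sdiff isClosed_singleton).mem_nhds ⟨h2, by simpa using hne.symm⟩) (f := f)
    (hf.mono (by rw [sdiff_sdiff]; rfl)) (M := N) (by simpa using hN)
  have hb : ∀ᶠ z in 𝓝[≠] (1 : ℂ), ‖(z - 1) * G z‖ ≤ M + (‖b / ((1:ℂ) + 1)‖ * 0 + 1) := by
    have hc : ContinuousAt (fun z : ℂ => ‖(z - 1) * (b / (z + 1))‖) 1 := by
      have : (1 : ℂ) + 1 ≠ 0 := by norm_num
      fun_prop (disch := assumption)
    have hev : ∀ᶠ z in 𝓝[≠] (1 : ℂ), ‖(z - 1) * (b / (z + 1))‖ < 1 := by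
      apply eventually_nhdsWithin_of_eventually_nhds
      exact hc.eventually_lt continuousAt_const (by simp)
    have hAe : ∀ᶠ z in 𝓝[≠] (1 : ℂ), z ∈ A \ {-1} :=
      eventually_nhdsWithin_of_eventually_nhds (hopen.mem_nhds ⟨h1, by simpa using hne⟩)
    filter_upwards [hM, hev, hAe, self_mem_nhdsWithin] with z hz1 hz2 hz3 hz4
    have := hfG z ⟨hz3.1, by simpa using hz4⟩ hz3.2
    have h : (z - 1) * G z = (z - 1) * f z - (z - 1) * (b / (z + 1)) := by
      rw [this]; ring_nf
    rw [h]
    have := norm_sub_le ((z - 1) * f z) ((z - 1) * (b / (z + 1)))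
    linarith
  obtain ⟨a, K, hK, hGK⟩ := one_step (hAo.mem_nhds h1) hG hb
  refine ⟨a, b, K, hK, fun z hz hz1 hz2 => ?_⟩
  rw [hfG z ⟨hz, hz1⟩ hz2, hGK z hz hz1]
  ring_nf

lemma residue {r q s : ℝ} (hr : 0 < r) (hs1 : s < 1) (hrs : r < s) (hsq : s * s = q)
    {W : ℂ → ℂ} (hW : DifferentiableOn ℂ W (Ann r)) {b : ℂ}
    (hinv : ∀ z : ℂ, ‖z‖ = s⁻¹ → b / (q * z + 1) + W (q * z) = b / (z + 1) + W z) : b = 0 := by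
  have hs : 0 < s := hr.trans hrs
  have hs2 : 1 < s⁻¹ := (one_lt_inv₀ hs).2 hs1
  have hsr : s⁻¹ < r⁻¹ := (inv_lt_inv₀ hs hr).2 hrs
  have key : (∮ z in C(0, s), z⁻¹ • (b / (z + 1) + W z))
      = ∮ z in C(0, s⁻¹), z⁻¹ • (b / (z + 1) + W z) := by
    have hgen : ∀ R : ℝ, R ≠ 0 → (∮ z in C(0, R), z⁻¹ • (b / (z + 1) + W z))
        = ∫ θ in (0:ℝ)..2 * Real.pi,
          Complex.I * (b / (circleMap 0 R θ + 1) + W (circleMap 0 R θ)) := by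
      intro R hR
      unfold circleIntegral
      congr 1
      ext θ
      have : circleMap 0 R θ ≠ 0 := circleMap_ne_center hR
      simp only [deriv_circleMap, smul_eq_mul]
      field_simp
    rw [hgen s hs.ne', hgen s⁻¹ (by positivity)]
    congr 1
    ext θ
    have e : circleMap 0 s θ = q * circleMap 0 s⁻¹ θ := by
      have : (s : ℂ) ≠ 0 := by exact_mod_cast hs.ne'
      simp only [circleMap, zero_add, ← hsq]
      push_cast
      field_simp
    rw [e, hinv]
    simp [circleMap, abs_of_pos hs]
  have hsplit : ∀ R : ℝ, 0 < R → r < R → R < r⁻¹ → R ≠ 1 →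
      (∮ z in C(0, R), z⁻¹ • (b / (z + 1) + W z)) =
      b * (2 * Real.pi * Complex.I) - b * (∮ z in C(0, R), (z - (-1))⁻¹) +
        ∮ z in C(0, R), (z - 0)⁻¹ • W z := by
    intro R hR h1 h2 h3
    have hz0 : ∀ z ∈ sphere (0:ℂ) R, z ≠ 0 := by
      rintro z hz rfl
      simp at hz
      exact hR.ne hz
    have hz1 : ∀ z ∈ sphere (0:ℂ) R, z + 1 ≠ 0 := by
      rintro z hz h
      rw [eq_neg_of_add_eq_zero_left h] at hz
      simp at hz
      exact h3 hz.symm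
    have i1 : CircleIntegrable (fun z : ℂ => b * (z - 0)⁻¹) 0 R := by
      apply ContinuousOn.circleIntegrable hR.le
      refine continuousOn_const.mul (ContinuousOn.inv₀ (by fun_prop) ?_)
      intro z hz; simpa using hz0 z hz
    have i2 : CircleIntegrable (fun z : ℂ => b * (z - (-1))⁻¹) 0 R := by
      apply ContinuousOn.circleIntegrable hR.le
      refine continuousOn_const.mul (ContinuousOn.inv₀ (by fun_prop) ?_)
      intro z hz; simpa using hz1 z hz
    have i3 : CircleIntegrable (fun z : ℂ => (z - 0)⁻¹ • W z) 0 R := by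
      apply ContinuousOn.circleIntegrable hR.le
      refine ContinuousOn.smul (f := fun z : ℂ => (z - 0)⁻¹)
        (ContinuousOn.inv₀ (by fun_prop) ?_) (hW.continuousOn.mono ?_)
      · intro z hz; simpa using hz0 z hz
      · intro z hz
        simp at hz
        simp [Ann, hz, h1, h2]
    have e1 : (∮ z in C(0, R), z⁻¹ • (b / (z + 1) + W z)) =
        ∮ z in C(0, R), (b * (z - 0)⁻¹ - b * (z - (-1))⁻¹) + (z - 0)⁻¹ • W z := by
      apply circleIntegral.integral_congr hR.le
      intro z hz
      have := hz0 z hz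
      have h' := hz1 z hz
      simp only [sub_zero, sub_neg_eq_add, smul_eq_mul]
      field_simp
      ring
    have i12 : CircleIntegrable (fun z : ℂ => b * (z - 0)⁻¹ - b * (z - (-1))⁻¹) 0 R := i1.sub i2
    rw [e1, circleIntegral.integral_add i12 i3, circleIntegral.integral_sub i1 i2,
      circleIntegral.integral_const_mul, circleIntegral.integral_const_mul,
      circleIntegral.integral_sub_center_inv _ hR.ne']
  have hWeq : (∮ z in C(0, s⁻¹), (z - 0)⁻¹ • W z) = ∮ z in C(0, s), (z - 0)⁻¹ • W z := by
    apply Complex.circleIntegral_sub_center_inv_smul_eq_of_differentiable_on_annulus_off_countable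
      hs (by linarith) countable_empty
    · apply hW.continuousOn.mono
      rintro z ⟨h1, h2⟩
      simp at h1 h2
      exact ⟨by linarith, by linarith⟩
    · rintro z ⟨⟨h1, h2⟩, -⟩
      simp at h1 h2
      exact hW.differentiableAt ((isOpen_ann r).mem_nhds ⟨by linarith, by linarith⟩)
  have hin : (∮ z in C(0, s), (z - (-1) : ℂ)⁻¹) = 0 := by
    apply Complex.circleIntegral_eq_zero_of_differentiable_on_off_countable hs.le countable_empty
    · refine ContinuousOn.inv₀ (by fun_prop) ?_
      intro z hz h
      rw [sub_eq_zero.1 h] at hz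
      simp at hz
      linarith
    · rintro z ⟨hz, -⟩
      have : z - (-1) ≠ 0 := by
        intro h
        rw [sub_eq_zero.1 h] at hz
        simp at hz
        linarith
      fun_prop (disch := assumption)
  have hout : (∮ z in C(0, s⁻¹), (z - (-1) : ℂ)⁻¹) = 2 * Real.pi * Complex.I :=
    circleIntegral.integral_sub_inv_of_mem_ball (by simpa using hs2)
  rw [hsplit s hs hrs (by linarith) hs1.ne, hsplit s⁻¹ (by positivity) (by linarith) hsr hs2.ne',
    hWeq, hin, hout] at key
  have : b * (2 * Real.pi * Complex.I) = 0 := by linear_combination key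
  exact (mul_eq_zero.1 this).resolve_right Complex.two_pi_I_ne_zero

lemma norm_qpow {q : ℝ} (hq0 : 0 < q) (k : ℤ) : ‖(q : ℂ) ^ k‖ = q ^ k := by
  rw [norm_zpow, Complex.norm_real, Real.norm_of_nonneg hq0.le]

lemma dom_zpow {q : ℝ} (hq0 : 0 < q) {z : ℂ} (hz : Dom q z) (n : ℤ) :
    Dom q ((q : ℂ) ^ n * z) := by
  have hq : (q : ℂ) ≠ 0 := by exact_mod_cast hq0.ne'
  refine ⟨mul_ne_zero (zpow_ne_zero _ hq) hz.1, fun k => ⟨fun h => (hz.2 (k - n)).1 ?_,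
    fun h => (hz.2 (k - n)).2 ?_⟩⟩
  · rw [zpow_sub₀ hq, ← h]; field_simp
  · rw [zpow_sub₀ hq, ← neg_div, ← h]; field_simp

lemma inv_q_zpow {q : ℝ} (hq0 : 0 < q) {f : ℂ → ℂ}
    (hf : ∀ z, Dom q z → f (q * z) = f z) (n : ℤ) {z : ℂ} (hz : Dom q z) :
    f ((q : ℂ) ^ n * z) = f z := by
  have hq : (q : ℂ) ≠ 0 := by exact_mod_cast hq0.ne'
  induction n with
  | zero => simp
  | succ i ih =>
    rw [← ih, ← hf _ (dom_zpow hq0 hz i), zpow_add_one₀ hq]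
    congr 1; ring
  | pred i ih =>
    rw [← ih, ← hf _ (dom_zpow hq0 hz (-i - 1)), zpow_sub_one₀ hq]
    congr 1; field_simp

lemma hZero_inv {q : ℝ} (hq0 : 0 < q) (z : ℂ) : hZero q (q * z) = hZero q z := by
  have hq : (q : ℂ) ≠ 0 := by exact_mod_cast hq0.ne'
  unfold hZero
  rw [← (Equiv.addRight (1 : ℤ)).tsum_eq]
  congr 1
  ext k
  simp only [Equiv.coe_addRight]
  have e1 : (q : ℂ) ^ (k + 1) = q * q ^ k := by rw [zpow_add_one₀ hq]; ring
  have e2 : (q : ℂ) ^ (2 * (k + 1)) = q ^ 2 * q ^ (2 * k) := by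
    rw [show 2 * (k + 1) = 2 * k + 1 + 1 by ring, zpow_add_one₀ hq, zpow_add_one₀ hq]; ring
  rw [e1, e2, show 2 * (↑q * z) * (↑q * (q:ℂ) ^ k) = q ^ 2 * (2 * z * q ^ k) by ring,
    show (↑q * z) ^ 2 - (q:ℂ) ^ 2 * ↑q ^ (2 * k) = q ^ 2 * (z ^ 2 - q ^ (2 * k)) by ring,
    mul_div_mul_left _ _ (pow_ne_zero 2 hq)]

/-- Every nonzero point can be moved into the fundamental annulus. -/
lemma exists_fund {q s : ℝ} (hq0 : 0 < q) (hq1 : q < 1) (hs : 0 < s) (hsq : s * s = q)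
    {z : ℂ} (hz : z ≠ 0) : ∃ n : ℤ, s ≤ ‖(q : ℂ) ^ n * z‖ ∧ ‖(q : ℂ) ^ n * z‖ ≤ s⁻¹ := by
  obtain ⟨n, h1, h2⟩ := exists_mem_Ico_zpow (x := ‖z‖ / s) (y := q⁻¹)
    (div_pos (norm_pos_iff.2 hz) hs) ((one_lt_inv₀ hq0).2 hq1)
  have hp : 0 < q ^ n := zpow_pos hq0 n
  refine ⟨n, ?_⟩
  rw [norm_mul, norm_qpow hq0]
  rw [inv_zpow, le_div_iff₀ hs, inv_mul_le_iff₀ hp] at h1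
  rw [zpow_add_one₀ (inv_ne_zero hq0.ne'), inv_zpow, div_lt_iff₀ hs] at h2
  refine ⟨h1, ?_⟩
  have h3 : q ^ n * ‖z‖ < q ^ n * ((q ^ n)⁻¹ * q⁻¹ * s) := by gcongr
  have h4 : q ^ n * ((q ^ n)⁻¹ * q⁻¹ * s) = s⁻¹ := by
    rw [← hsq]; field_simp
  linarith

/-- Points of the annulus other than `±1` are in the domain. -/
lemma dom_of_ann {q r : ℝ} (hq0 : 0 < q) (hq1 : q < 1) (hqr : q < r)
    {z : ℂ} (hz : z ∈ Ann r) (h1 : z ≠ 1) (h2 : z ≠ -1) : Dom q z := by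
  have hr : 0 < r := hq0.trans hqr
  have hk : ∀ k : ℤ, ‖z‖ = q ^ k → k = 0 := by
    intro k hk
    obtain ⟨a, b⟩ := hz
    rw [hk] at a b
    rcases lt_trichotomy k 0 with h | h | h
    · exfalso
      have : q ^ (-1 : ℤ) ≤ q ^ k := zpow_le_zpow_right_of_le_one₀ hq0 hq1.le (by omega)
      rw [zpow_neg_one] at this
      have := (inv_lt_inv₀ hr hq0).2 hqr
      linarith
    · exact h
    · exfalso
      have : q ^ k ≤ q ^ (1 : ℤ) := zpow_le_zpow_right_of_le_one₀ hq0 hq1.le (by omega)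
      rw [zpow_one] at this
      linarith
  refine ⟨?_, fun k => ⟨?_, ?_⟩⟩
  · rintro rfl
    have := hz.1
    simp at this
    linarith
  · intro h
    have := hk k (by rw [h, norm_qpow hq0])
    subst this
    exact h1 (by simpa using h)
  · intro h
    have := hk k (by rw [h, norm_neg, norm_qpow hq0])
    subst this
    exact h2 (by simpa using h)

lemma term_bound {q r : ℝ} (hq0 : 0 < q) (hq1 : q < 1) (hqr : q < r) (k : ℤ) (hk : k ≠ 0)
    {z : ℂ} (hz : z ∈ Ann r) :
    ‖2 * z * (q : ℂ) ^ k / (z ^ 2 - (q : ℂ) ^ (2 * k))‖ ≤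
      (2 * r⁻¹ * (r ^ 2 - q ^ 2)⁻¹) * q ^ k.natAbs ∧ z ^ 2 - (q : ℂ) ^ (2 * k) ≠ 0 := by
  have hr : 0 < r := hq0.trans hqr
  have hD : 0 < r ^ 2 - q ^ 2 := by nlinarith
  obtain ⟨hz1, hz2⟩ := hz
  have hr1 : r < 1 := by
    by_contra h
    have : r⁻¹ ≤ 1 := inv_le_one_of_one_le₀ (not_lt.1 h)
    linarith
  have hw : (q : ℂ) ^ (2 * k) = ((q : ℂ) ^ k) ^ 2 := by
    rw [mul_comm, zpow_mul]; norm_cast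
  have hwn : ‖(q : ℂ) ^ k‖ = q ^ k := norm_qpow hq0 k
  rw [hw]
  generalize (q : ℂ) ^ k = w at *
  have hx : 0 < q ^ k := zpow_pos hq0 k
  have hy : 0 < q ^ k.natAbs := pow_pos hq0 _
  have hyq : q ^ k.natAbs ≤ q := by
    have := pow_le_pow_of_le_one hq0.le hq1.le (show 1 ≤ k.natAbs by omega)
    simpa using this
  have hxy : q ^ k = q ^ k.natAbs ∨ q ^ k * q ^ k.natAbs = 1 := by
    rcases lt_or_gt_of_ne hk with h | h
    · right
      rw [← zpow_natCast, ← zpow_add₀ hq0.ne', show k + (k.natAbs : ℤ) = 0 by omega, zpow_zero]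
    · left
      rw [← zpow_natCast, show (k.natAbs : ℤ) = k by omega]
  generalize q ^ k.natAbs = y at *
  generalize q ^ k = x at *
  have hmain : (r ^ 2 - q ^ 2) * x ≤ y * ‖z ^ 2 - w ^ 2‖ := by
    rcases hxy with h | h
    · subst h
      have h1 := norm_sub_norm_le (z ^ 2) (w ^ 2)
      rw [norm_pow, norm_pow, hwn] at h1
      have h2 : r ^ 2 ≤ ‖z‖ ^ 2 := by gcongr
      have h3 : x ^ 2 ≤ q ^ 2 := by gcongr
      rw [mul_comm]
      gcongr
      linarith
    · have h1 := norm_sub_norm_le (w ^ 2) (z ^ 2)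
      rw [norm_pow, norm_pow, hwn, norm_sub_rev] at h1
      have h2 : ‖z‖ ^ 2 ≤ r⁻¹ ^ 2 := by gcongr
      have h3 : y * (x ^ 2 - r⁻¹ ^ 2) ≤ y * ‖z ^ 2 - w ^ 2‖ := by gcongr; linarith
      refine le_trans ?_ h3
      have h4 : y * (x ^ 2 - r⁻¹ ^ 2) = x * (1 - y ^ 2 * r⁻¹ ^ 2) := by
        linear_combination (x + y * r⁻¹ ^ 2) * h
      rw [h4, mul_comm]
      refine mul_le_mul_of_nonneg_left ?_ hx.le
      have h5 : y ^ 2 * r⁻¹ ^ 2 ≤ q ^ 2 * r⁻¹ ^ 2 := by gcongr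
      have h6 : r ^ 2 - q ^ 2 ≤ (r ^ 2 - q ^ 2) * r⁻¹ ^ 2 := by
        apply le_mul_of_one_le_right hD.le
        apply one_le_pow₀
        exact (one_le_inv₀ hr).2 hr1.le
      have h7 : (r ^ 2 - q ^ 2) * r⁻¹ ^ 2 = 1 - q ^ 2 * r⁻¹ ^ 2 := by field_simp
      linarith
  have hne : 0 < ‖z ^ 2 - w ^ 2‖ := by
    have : 0 < y * ‖z ^ 2 - w ^ 2‖ := lt_of_lt_of_le (by positivity) hmain
    exact pos_of_mul_pos_right this hy.le
  refine ⟨?_, norm_pos_iff.1 hne⟩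
  rw [norm_div, norm_mul, norm_mul, hwn, div_le_iff₀ hne]
  have h1 : x ≤ (r ^ 2 - q ^ 2)⁻¹ * (y * ‖z ^ 2 - w ^ 2‖) := by
    rw [← div_eq_inv_mul, le_div_iff₀ hD]; linarith
  have h2 : ‖(2:ℂ)‖ * ‖z‖ * x ≤ 2 * r⁻¹ * ((r ^ 2 - q ^ 2)⁻¹ * (y * ‖z ^ 2 - w ^ 2‖)) := by
    rw [Complex.norm_ofNat]
    gcongr
  linarith

lemma tail {q r : ℝ} (hq0 : 0 < q) (hq1 : q < 1) (hqr : q < r) :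
    ∃ T : ℂ → ℂ, DifferentiableOn ℂ T (Ann r) ∧ ∀ z ∈ Ann r, z ≠ 1 → z ≠ -1 →
      hZero q z = 1 / (z - 1) + 1 / (z + 1) + T z := by
  have hsum : Summable fun k : ℤ => (2 * r⁻¹ * (r ^ 2 - q ^ 2)⁻¹) * q ^ k.natAbs := by
    apply Summable.mul_left
    apply Summable.of_nat_of_neg <;>
    simpa using summable_geometric_of_lt_one hq0.le hq1
  have hpos : 0 < 2 * r⁻¹ * (r ^ 2 - q ^ 2)⁻¹ := by
    have : 0 < r ^ 2 - q ^ 2 := by nlinarith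
    have : 0 < r := hq0.trans hqr
    positivity
  have hb : ∀ (k : ℤ) (z : ℂ), z ∈ Ann r →
      ‖if k = 0 then 0 else 2 * z * (q : ℂ) ^ k / (z ^ 2 - (q : ℂ) ^ (2 * k))‖ ≤
      (2 * r⁻¹ * (r ^ 2 - q ^ 2)⁻¹) * q ^ k.natAbs := by
    intro k z hz
    split_ifs with h
    · simp; positivity
    · exact (term_bound hq0 hq1 hqr k h hz).1
  refine ⟨fun z => ∑' k : ℤ, if k = 0 then 0 else
    2 * z * (q : ℂ) ^ k / (z ^ 2 - (q : ℂ) ^ (2 * k)), ?_, ?_⟩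
  · refine Complex.differentiableOn_tsum_of_summable_norm hsum ?_ (isOpen_ann r) hb
    intro k
    by_cases h : k = 0
    · simp [h]
    · simp only [h, if_false]
      refine DifferentiableOn.div (by fun_prop) (by fun_prop) ?_
      intro z hz
      exact (term_bound hq0 hq1 hqr k h hz).2
  · intro z hz h1 h2
    have hs : Summable fun k : ℤ => 2 * z * (q : ℂ) ^ k / (z ^ 2 - (q : ℂ) ^ (2 * k)) := by
      have := Summable.of_norm_bounded hsum (fun k => hb k z hz)
      refine this.congr_cofinite ?_
      have : ({0}ᶜ : Set ℤ) ∈ cofinite := (finite_singleton 0).compl_mem_cofinite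
      filter_upwards [this] with k hk
      rw [if_neg (by simpa using hk)]
    rw [hZero, hs.tsum_eq_add_tsum_ite 0]
    congr 1
    have a1 : z - 1 ≠ 0 := sub_ne_zero.2 h1
    have a2 : z + 1 ≠ 0 := fun h => h2 (eq_neg_of_add_eq_zero_left h)
    have a3 : z ^ 2 - 1 ≠ 0 := by
      rw [show z ^ 2 - 1 = (z - 1) * (z + 1) by ring]; exact mul_ne_zero a1 a2
    simp only [zpow_zero, mul_zero, mul_one]
    rw [show z ^ 2 - 1 = (z - 1) * (z + 1) by ring]
    field_simp
    ring

lemma const_of_inv {q r s : ℝ} (hq0 : 0 < q) (hq1 : q < 1) (hqr : q < r) (hrs : r < s)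
    (hs1 : s < 1) (hsq : s * s = q) {D W : ℂ → ℂ} (hW : DifferentiableOn ℂ W (Ann r))
    (hD : ∀ z, Dom q z → D (q * z) = D z)
    (hDW : ∀ z ∈ Ann r, z ≠ 1 → z ≠ -1 → D z = W z) :
    ∃ c, ∀ z, Dom q z → D z = c := by
  have hr : 0 < r := hq0.trans hqr
  have hs : 0 < s := hr.trans hrs
  have hs2 : 1 < s⁻¹ := (one_lt_inv₀ hs).2 hs1
  have hsr : s⁻¹ < r⁻¹ := (inv_lt_inv₀ hs hr).2 hrs
  set K : Set ℂ := closedBall 0 s⁻¹ \ ball 0 s with hK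
  have hKm : ∀ z, z ∈ K ↔ s ≤ ‖z‖ ∧ ‖z‖ ≤ s⁻¹ := by
    intro z; simp [hK, and_comm]
  have hKA : K ⊆ Ann r := by
    intro z hz
    rw [hKm] at hz
    exact ⟨by linarith, by linarith⟩
  have hKc : IsCompact K := (isCompact_closedBall _ _).diff isOpen_ball
  have h1K : (1 : ℂ) ∈ K := by rw [hKm]; simp; exact ⟨hs1.le, hs2.le⟩
  have h2K : (-1 : ℂ) ∈ K := by rw [hKm]; simp; exact ⟨hs1.le, hs2.le⟩
  have hmove : ∀ z, Dom q z → ∃ w ∈ K, D z = W w := by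
    intro z hz
    obtain ⟨n, h1, h2⟩ := exists_fund hq0 hq1 hs hsq hz.1
    have hm : (q : ℂ) ^ n * z ∈ K := (hKm _).2 ⟨h1, h2⟩
    have hd := dom_zpow hq0 hz n
    refine ⟨_, hm, ?_⟩
    rw [← inv_q_zpow hq0 hD n hz]
    refine hDW _ (hKA hm) ?_ ?_
    · simpa using (hd.2 0).1
    · simpa using (hd.2 0).2
  obtain ⟨z0, hz0, hmax⟩ := hKc.exists_isMaxOn ⟨1, h1K⟩ (hW.continuousOn.mono hKA).norm
  have hmaxA : IsMaxOn (norm ∘ W) (Ann r) z0 := by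
    intro z hz
    by_cases h1 : z = 1
    · subst h1; exact hmax h1K
    by_cases h2 : z = -1
    · subst h2; exact hmax h2K
    obtain ⟨w, hw, hzw⟩ := hmove z (dom_of_ann hq0 hq1 hqr hz h1 h2)
    have := hmax hw
    simp only [mem_ofPred_eq, Function.comp] at this ⊢
    rwa [← hDW z hz h1 h2, hzw]
  have hcst := Complex.eqOn_of_isPreconnected_of_isMaxOn_norm (preconn_ann hr) (isOpen_ann r) hW
    (hKA hz0) hmaxA
  refine ⟨W z0, fun z hz => ?_⟩
  obtain ⟨w, hw, hzw⟩ := hmove z hz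
  rw [hzw]
  exact hcst (hKA hw)

theorem main (q : ℝ) (hq0 : 0 < q) (hq1 : q < 1) (C : ℂ → ℂ)
    (hC : AnalyticOn ℂ C {z : ℂ | Dom q z})
    (hpolePos : ∀ k : ℤ, ∃ M ε : ℝ, 0 < ε ∧ ∀ z : ℂ, Dom q z →
        ‖z - (q : ℂ) ^ k‖ < ε → ‖(z - (q : ℂ) ^ k) * C z‖ ≤ M)
    (hpoleNeg : ∀ k : ℤ, ∃ M ε : ℝ, 0 < ε ∧ ∀ z : ℂ, Dom q z →
        ‖z + (q : ℂ) ^ k‖ < ε → ‖(z + (q : ℂ) ^ k) * C z‖ ≤ M)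
    (hinv : ∀ z : ℂ, Dom q z → C ((q : ℂ) * z) = C z) :
    ∃ c₀ c₁ : ℂ, ∀ z : ℂ, Dom q z → C z = c₁ * hZero q z + c₀ := by
  set s := √q with hsdef
  have hs : 0 < s := Real.sqrt_pos.2 hq0
  have hsq : s * s = q := Real.mul_self_sqrt hq0.le
  have hs1 : s < 1 := by nlinarith
  obtain ⟨r, hqr, hrs⟩ := exists_between (show q < s by nlinarith)
  have hr : 0 < r := hq0.trans hqr
  have hs2 : 1 < s⁻¹ := (one_lt_inv₀ hs).2 hs1
  have hsr : s⁻¹ < r⁻¹ := (inv_lt_inv₀ hs hr).2 hrs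
  have h1A : (1 : ℂ) ∈ Ann r := ⟨by simp; linarith, by simp; linarith⟩
  have h2A : (-1 : ℂ) ∈ Ann r := ⟨by simp; linarith, by simp; linarith⟩
  have hne : (1 : ℂ) ≠ -1 := by norm_num [Complex.ext_iff]
  have hCd : DifferentiableOn ℂ C (Ann r \ {1, -1}) := by
    apply hC.differentiableOn.mono
    rintro z ⟨hz, hz'⟩
    simp only [mem_insert_iff, mem_singleton_iff, not_or] at hz'
    exact dom_of_ann hq0 hq1 hqr hz hz'.1 hz'.2
  obtain ⟨M, ε, hε, hM⟩ := hpolePos 0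
  obtain ⟨N, δ, hδ, hN⟩ := hpoleNeg 0
  simp only [zpow_zero] at hM hN
  have hM' : ∀ᶠ z in 𝓝[≠] (1 : ℂ), ‖(z - 1) * C z‖ ≤ M := by
    have e1 : ∀ᶠ z in 𝓝[≠] (1 : ℂ), z ∈ Ann r ∩ {-1}ᶜ ∩ ball 1 ε :=
      eventually_nhdsWithin_of_eventually_nhds ((((isOpen_ann r).inter
        isOpen_compl_singleton).inter isOpen_ball).mem_nhds
          ⟨⟨h1A, by simpa using hne⟩, mem_ball_self hε⟩)
    filter_upwards [e1, self_mem_nhdsWithin] with z hz hz1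
    exact hM z (dom_of_ann hq0 hq1 hqr hz.1.1 hz1 hz.1.2) (by simpa [dist_eq_norm] using hz.2)
  have hN' : ∀ᶠ z in 𝓝[≠] (-1 : ℂ), ‖(z + 1) * C z‖ ≤ N := by
    have e1 : ∀ᶠ z in 𝓝[≠] (-1 : ℂ), z ∈ Ann r ∩ {1}ᶜ ∩ ball (-1) δ :=
      eventually_nhdsWithin_of_eventually_nhds ((((isOpen_ann r).inter
        isOpen_compl_singleton).inter isOpen_ball).mem_nhds
          ⟨⟨h2A, by simpa using hne.symm⟩, mem_ball_self hδ⟩)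
    filter_upwards [e1, self_mem_nhdsWithin] with z hz hz1
    exact hN z (dom_of_ann hq0 hq1 hqr hz.1.1 hz.1.2 hz1) (by simpa [dist_eq_norm] using hz.2)
  obtain ⟨a, b, G, hG, hCG⟩ := decomp (isOpen_ann r) h1A h2A hCd hM' hN'
  obtain ⟨T, hT, hhT⟩ := tail hq0 hq1 hqr
  set D : ℂ → ℂ := fun z => C z - a * hZero q z with hDdef
  have hW : DifferentiableOn ℂ (fun z => G z - a * T z) (Ann r) :=
    hG.sub ((differentiableOn_const a).mul hT)
  have hDinv : ∀ z, Dom q z → D (q * z) = D z := by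
    intro z hz
    simp only [hDdef, hinv z hz, hZero_inv hq0]
  have hDW : ∀ z ∈ Ann r, z ≠ 1 → z ≠ -1 → D z = (b - a) / (z + 1) + (G z - a * T z) := by
    intro z hz h1 h2
    simp only [hDdef, hCG z hz h1 h2, hhT z hz h1 h2]
    ring
  have hb : b - a = 0 := by
    refine residue hr hs1 hrs hsq hW ?_
    intro z hz
    have hzq : ‖(q : ℂ) * z‖ = s := by
      rw [norm_mul, Complex.norm_real, Real.norm_of_nonneg hq0.le, hz, ← hsq]
      field_simp
    have hz1 : z ≠ 1 := by rintro rfl; simp at hz; linarith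
    have hz2 : z ≠ -1 := by rintro rfl; simp at hz; linarith
    have hz3 : (q : ℂ) * z ≠ 1 := by intro h; rw [h] at hzq; simp at hzq; linarith
    have hz4 : (q : ℂ) * z ≠ -1 := by intro h; rw [h] at hzq; simp at hzq; linarith
    have hzA : z ∈ Ann r := ⟨by linarith, by linarith⟩
    have hzA' : (q : ℂ) * z ∈ Ann r := ⟨by linarith, by linarith⟩
    have := hDinv z (dom_of_ann hq0 hq1 hqr hzA hz1 hz2)
    rwa [hDW z hzA hz1 hz2, hDW _ hzA' hz3 hz4] at this
  obtain ⟨c, hc⟩ := const_of_inv hq0 hq1 hqr hrs hs1 hsq hW hDinv (by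
    intro z hz h1 h2
    rw [hDW z hz h1 h2, hb]; simp)
  refine ⟨c, a, fun z hz => ?_⟩
  rw [← hc z hz]
  simp [hDdef]

end QEll

/-- a function analytic on `ℂ ∖ ({0} ∪ {±q^k : k ∈ ℤ})` with at worst
simple poles at the points `±q^k` and invariant under `z ↦ qz` is of the form
`c₁ h⁰(z) + c₀`. -/
theorem statement16 (q : ℝ) (hq0 : 0 < q) (hq1 : q < 1) (C : ℂ → ℂ)
    (hC : AnalyticOn ℂ C
      {z : ℂ | z ≠ 0 ∧ ∀ k : ℤ, z ≠ (q : ℂ) ^ k ∧ z ≠ -((q : ℂ) ^ k)})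
    (hpolePos : ∀ k : ℤ, ∃ M ε : ℝ, 0 < ε ∧ ∀ z : ℂ,
      (z ≠ 0 ∧ ∀ j : ℤ, z ≠ (q : ℂ) ^ j ∧ z ≠ -((q : ℂ) ^ j)) →
        ‖z - (q : ℂ) ^ k‖ < ε → ‖(z - (q : ℂ) ^ k) * C z‖ ≤ M)
    (hpoleNeg : ∀ k : ℤ, ∃ M ε : ℝ, 0 < ε ∧ ∀ z : ℂ,
      (z ≠ 0 ∧ ∀ j : ℤ, z ≠ (q : ℂ) ^ j ∧ z ≠ -((q : ℂ) ^ j)) →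
        ‖z + (q : ℂ) ^ k‖ < ε → ‖(z + (q : ℂ) ^ k) * C z‖ ≤ M)
    (hinv : ∀ z : ℂ, (z ≠ 0 ∧ ∀ k : ℤ, z ≠ (q : ℂ) ^ k ∧ z ≠ -((q : ℂ) ^ k)) →
      C ((q : ℂ) * z) = C z) :
    ∃ c₀ c₁ : ℂ, ∀ z : ℂ,
      (z ≠ 0 ∧ ∀ k : ℤ, z ≠ (q : ℂ) ^ k ∧ z ≠ -((q : ℂ) ^ k)) →
        C z = c₁ * hZero q z + c₀ := by
  exact QEll.main q hq0 hq1 C hC hpolePos hpoleNeg hinv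
end
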